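/- Let q = 2^h be a power of 2 and F a finite field with q elements. Let W₃ = { [[x, 0, z], [0, y, 0], [z, 0, 0]] : x, y, z ∈ F } ⊆ Sym₃(F). Then the point-orbit distribution of W₃ is [2, 1, 2q−2, q²−q]: W₃ has exactly 2 rank-1 points, exactly one rank-2 point with zero diagonal, exactly 2q−2 rank-2 points with nonzero diagonal, and exactly q²−q rank-3 points. -/

import Mathlib

open Matrix

/-- A *point* of a plane `W` of `PG(5,q)` (viewed as a 3-dimensional linear subspace of the
space of symmetric `3×3` matrices): a 1-dimensional linear subspace `P ≤ W`, all of whose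
nonzero matrices satisfy the predicate `pred` (e.g. a rank condition). -/
def IsPointOf (F : Type) [Field F] (W P : Submodule F (Matrix (Fin 3) (Fin 3) F))
    (pred : Matrix (Fin 3) (Fin 3) F → Prop) : Prop :=
  P ≤ W ∧ Module.finrank F ↥P = 1 ∧ ∀ M ∈ P, M ≠ 0 → pred M

/-- The matrix of the plane with coordinates `x, y, z`. -/
def planeMatrix {F : Type} [Field F] (x y z : F) : Matrix (Fin 3) (Fin 3) F :=
  !![x, 0, z; 0, y, 0; z, 0, 0]

theorem planeMatrix_inj {F : Type} [Field F] {x y z x' y' z' : F} :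
    planeMatrix x y z = planeMatrix x' y' z' ↔ x = x' ∧ y = y' ∧ z = z' := by
  constructor
  · intro e
    exact ⟨congrFun (congrFun e 0) 0, congrFun (congrFun e 1) 1, congrFun (congrFun e 0) 2⟩
  · rintro ⟨rfl, rfl, rfl⟩
    rfl

theorem planeMatrix_zero {F : Type} [Field F] : planeMatrix (0 : F) 0 0 = 0 := by
  ext i j
  fin_cases i <;> fin_cases j <;> rfl

theorem planeMatrix_eq_zero {F : Type} [Field F] {x y z : F} :
    planeMatrix x y z = 0 ↔ x = 0 ∧ y = 0 ∧ z = 0 := by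
  rw [← planeMatrix_zero, planeMatrix_inj]

theorem smul_planeMatrix {F : Type} [Field F] (c x y z : F) :
    c • planeMatrix x y z = planeMatrix (c * x) (c * y) (c * z) := by
  ext i j
  fin_cases i <;> fin_cases j <;> simp [planeMatrix]

theorem rank_diagonal_fin_three {F : Type} [Field F] [DecidableEq F] (a b c : F) :
    (diagonal ![a, b, c]).rank =
      (if a = 0 then 0 else 1) + (if b = 0 then 0 else 1) + (if c = 0 then 0 else 1) := by
  rw [rank_diagonal, Fintype.card_subtype, Finset.card_filter, Fin.sum_univ_three]
  by_cases ha : a = 0 <;> by_cases hb : b = 0 <;> by_cases hc : c = 0 <;> simp [ha, hb, hc]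

theorem rank_planeMatrix {F : Type} [Field F] [DecidableEq F] (x y z : F) :
    (planeMatrix x y z).rank =
      (if z = 0 then (if x = 0 then 0 else 1) else 2) + (if y = 0 then 0 else 1) := by
  by_cases hz : z = 0
  · have e : planeMatrix x y z = diagonal ![x, y, 0] := by
      ext i j
      fin_cases i <;> fin_cases j <;> simp [planeMatrix, hz]
    rw [e, rank_diagonal_fin_three]
    simp [hz]
  · have e : planeMatrix x y z = diagonal ![1, y, 1] * planeMatrix x 1 z := by
      ext i j
      fin_cases i <;> fin_cases j <;> simp [planeMatrix]
    have hdet : IsUnit (planeMatrix x 1 z).det := by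
      rw [isUnit_iff_ne_zero, planeMatrix, det_fin_three]
      simp [hz]
    rw [e, rank_mul_eq_left_of_isUnit_det _ _ hdet, rank_diagonal_fin_three]
    simp [hz]
    ring

theorem forall_diag_planeMatrix {F : Type} [Field F] (x y z : F) :
    (∀ i, planeMatrix x y z i i = 0) ↔ x = 0 ∧ y = 0 := by
  simp [Fin.forall_fin_succ, planeMatrix]

theorem exists_diag_planeMatrix {F : Type} [Field F] (x y z : F) :
    (∃ i, planeMatrix x y z i i ≠ 0) ↔ x ≠ 0 ∨ y ≠ 0 := by
  simp [Fin.exists_fin_succ, planeMatrix]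

/-- Points satisfying a predicate are counted by any system of pairwise non-proportional
representatives. -/
theorem card_isPointOf_eq {F : Type} [Field F] {W : Submodule F (Matrix (Fin 3) (Fin 3) F)}
    {pred : Matrix (Fin 3) (Fin 3) F → Prop} {ι : Type} (f : ι → Matrix (Fin 3) (Fin 3) F)
    (hfW : ∀ i, f i ∈ W) (hf0 : ∀ i, f i ≠ 0)
    (hpred : ∀ i (c : F), c ≠ 0 → pred (c • f i))
    (hinj : ∀ i j (c : F), c • f i = f j → i = j)
    (hsurj : ∀ M ∈ W, M ≠ 0 → pred M → ∃ i, ∃ c : F, c • f i = M) :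
    Nat.card {P | IsPointOf F W P pred} = Nat.card ι := by
  symm
  refine Nat.card_congr (Equiv.ofBijective (fun i => ⟨F ∙ f i, ?_, ?_, ?_⟩) ⟨?_, ?_⟩)
  · simpa using hfW i
  · exact finrank_span_singleton (hf0 i)
  · intro M hM hM0
    obtain ⟨c, rfl⟩ := Submodule.mem_span_singleton.1 hM
    exact hpred i c fun hc => hM0 (by simp [hc])
  · intro i j hij
    have e : F ∙ f i = F ∙ f j := congrArg Subtype.val hij
    have hj : f j ∈ F ∙ f i := e ▸ Submodule.mem_span_singleton_self _
    obtain ⟨c, hc⟩ := Submodule.mem_span_singleton.1 hj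
    exact hinj i j c hc
  · rintro ⟨P, hPW, hP1, hP⟩
    obtain ⟨⟨M, hM⟩, hM0, hspan⟩ := finrank_eq_one_iff'.1 hP1
    have hM0' : M ≠ 0 := fun e => hM0 (Subtype.ext e)
    obtain ⟨i, c, rfl⟩ := hsurj M (hPW hM) hM0' (hP M hM hM0')
    have hc : c ≠ 0 := fun hc => hM0' (by simp [hc])
    refine ⟨i, Subtype.ext (le_antisymm ?_ ?_)⟩
    · rw [Submodule.span_singleton_le_iff_mem]
      simpa [smul_smul, hc] using P.smul_mem c⁻¹ hM
    · intro N hN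
      obtain ⟨d, hd⟩ := hspan ⟨N, hN⟩
      have hd' : d • c • f i = N := congrArg Subtype.val hd
      exact Submodule.mem_span_singleton.2 ⟨d * c, by rw [mul_smul, hd']⟩

theorem sigma3_point_orbit_distribution (h : ℕ) (hh : 0 < h)
    (F : Type) [Field F] [Fintype F] (hF : Fintype.card F = 2 ^ h)
    (W : Submodule F (Matrix (Fin 3) (Fin 3) F))
    (hW : (W : Set (Matrix (Fin 3) (Fin 3) F)) =
      {M | ∃ x y z : F, M = !![x, 0, z; 0, y, 0; z, 0, 0]}) :
    Nat.card {P | IsPointOf F W P (fun M => M.rank = 1)} = 2 ∧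
    Nat.card {P | IsPointOf F W P (fun M => M.rank = 2 ∧ ∀ i, M i i = 0)} = 1 ∧
    Nat.card {P | IsPointOf F W P (fun M => M.rank = 2 ∧ ∃ i, M i i ≠ 0)} = 2 * 2 ^ h - 2 ∧
    Nat.card {P | IsPointOf F W P (fun M => M.rank = 3)} = (2 ^ h) ^ 2 - 2 ^ h := by
  classical
  have hmem : ∀ M, M ∈ W ↔ ∃ x y z : F, M = planeMatrix x y z := fun M => by
    rw [← SetLike.mem_coe, hW]
    rfl
  have hmk : ∀ x y z : F, planeMatrix x y z ∈ W := fun x y z => (hmem _).2 ⟨x, y, z, rfl⟩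
  have hunits : Nat.card Fˣ = 2 ^ h - 1 := by
    rw [Nat.card_eq_fintype_card, Fintype.card_units, hF]
  refine ⟨?_, ?_, ?_, ?_⟩
  · rw [card_isPointOf_eq (ι := Bool)
      (fun b => if b then planeMatrix 1 0 0 else planeMatrix 0 1 0)]
    · simp
    · rintro (_ | _) <;> simp [hmk]
    · rintro (_ | _) <;> simp [planeMatrix_eq_zero]
    · rintro (_ | _) c hc <;> simp [smul_planeMatrix, rank_planeMatrix, hc]
    · rintro (_ | _) (_ | _) c <;> simp [smul_planeMatrix, planeMatrix_inj]
    · intro M hM _ hr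
      obtain ⟨x, y, z, rfl⟩ := (hmem M).1 hM
      rw [rank_planeMatrix] at hr
      by_cases hz : z = 0 <;> by_cases hx : x = 0 <;> by_cases hy : y = 0 <;>
        simp [hz, hx, hy, smul_planeMatrix, planeMatrix_inj] at hr ⊢
  · rw [card_isPointOf_eq (ι := Unit) (fun _ => planeMatrix 0 0 1)]
    · simp
    · exact fun _ => hmk _ _ _
    · simp [planeMatrix_eq_zero]
    · intro _ c hc
      rw [smul_planeMatrix, forall_diag_planeMatrix, rank_planeMatrix]
      simp [hc]
    · simp
    · rintro M hM - ⟨-, hd⟩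
      obtain ⟨x, y, z, rfl⟩ := (hmem M).1 hM
      obtain ⟨rfl, rfl⟩ := (forall_diag_planeMatrix x y z).1 hd
      exact ⟨(), z, by simp [smul_planeMatrix]⟩
  · rw [card_isPointOf_eq (ι := Fˣ ⊕ Fˣ)
      (Sum.elim (fun u => planeMatrix 1 (u : F) 0) (fun u => planeMatrix (u : F) 0 1))]
    · rw [Nat.card_sum, hunits]
      omega
    · rintro (u | u) <;> exact hmk _ _ _
    · rintro (u | u) <;> simp [planeMatrix_eq_zero]
    · rintro (u | u) c hc <;>
        rw [Sum.elim, smul_planeMatrix, exists_diag_planeMatrix, rank_planeMatrix] <;> simp [hc]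
    · rintro (u | u) (v | v) c <;>
        simp only [Sum.elim_inl, Sum.elim_inr, smul_planeMatrix, planeMatrix_inj, mul_one, mul_zero]
      · rintro ⟨rfl, huv, -⟩
        simpa [Units.ext_iff] using huv
      · exact fun e => absurd e.2.2 zero_ne_one
      · exact fun e => absurd e.2.1.symm v.ne_zero
      · rintro ⟨huv, -, rfl⟩
        simpa [Units.ext_iff] using huv
    · rintro M hM - ⟨hr, hd⟩
      obtain ⟨x, y, z, rfl⟩ := (hmem M).1 hM
      rw [exists_diag_planeMatrix] at hd
      rw [rank_planeMatrix] at hr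
      by_cases hz : z = 0
      · have hx : x ≠ 0 := by rintro rfl; split_ifs at hr <;> simp_all
        have hy : y ≠ 0 := by rintro rfl; simp [hz, hx] at hr
        refine ⟨.inl (Units.mk0 (x⁻¹ * y) (by simp [hx, hy])), x, ?_⟩
        simp [smul_planeMatrix, hz, hx]
      · have hy : y = 0 := by by_contra hy; simp [hz, hy] at hr
        have hx : x ≠ 0 := by simpa [hy] using hd
        refine ⟨.inr (Units.mk0 (z⁻¹ * x) (by simp [hx, hz])), z, ?_⟩
        simp [smul_planeMatrix, hz, hy]
  · rw [card_isPointOf_eq (ι := F × Fˣ) (fun p => planeMatrix p.1 (p.2 : F) 1)]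
    · rw [Nat.card_prod, hunits, Nat.card_eq_fintype_card, hF, Nat.mul_sub, sq, mul_one]
    · exact fun _ => hmk _ _ _
    · simp [planeMatrix_eq_zero]
    · intro p c hc
      simp [smul_planeMatrix, rank_planeMatrix, hc]
    · rintro ⟨a, u⟩ ⟨b, v⟩ c
      simp only [smul_planeMatrix, planeMatrix_inj, mul_one]
      rintro ⟨h₁, h₂, rfl⟩
      simpa [Units.ext_iff] using And.intro h₁ h₂
    · intro M hM _ hr
      obtain ⟨x, y, z, rfl⟩ := (hmem M).1 hM
      rw [rank_planeMatrix] at hr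
      have hz : z ≠ 0 := by rintro rfl; split_ifs at hr <;> simp_all
      have hy : y ≠ 0 := by rintro rfl; simp [hz] at hr
      refine ⟨(z⁻¹ * x, Units.mk0 (z⁻¹ * y) (by simp [hy, hz])), z, ?_⟩
      simp [smul_planeMatrix, hz]
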